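/- arXiv:2008.04960 — 2 statements merged into one kernel-verified Lean document; each statement's English description precedes it below -/
import Mathlib

section
/- Let p be a prime and let G be an open subgroup of GL₂(ℤ_p). Then an element g of G lies in the center of G if and only if g is a scalar matrix, i.e. g = u·I₂ for some unit u of ℤ_p. In other words, the center of G consists exactly of the scalar matrices contained in G. -/
open Filter Topology in
/-- An open subgroup of `GL₂(ℤ_p)` contains `1 + c • N` for some `c ≠ 0`, for every `N` of square
zero. -/
theorem exists_one_add_smul_mem_of_isOpen {p : ℕ} [Fact p.Prime]
    {G : Subgroup (GL (Fin 2) ℤ_[p])} (hG : IsOpen (G : Set (GL (Fin 2) ℤ_[p])))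
    {N : Matrix (Fin 2) (Fin 2) ℤ_[p]} (hN : N * N = 0) :
    ∃ c : ℤ_[p], c ≠ 0 ∧ ∃ h ∈ G, (h : Matrix (Fin 2) (Fin 2) ℤ_[p]) = 1 + c • N := by
  let f : ℤ_[p] → GL (Fin 2) ℤ_[p] := fun c ↦
    { val := 1 + c • N
      inv := 1 - c • N
      val_inv := by simp [mul_sub, add_mul, hN]
      inv_val := by simp [mul_add, sub_mul, hN] }
  have hf : Continuous f := Units.continuous_iff.2
    ⟨continuous_const.add (continuous_id.smul continuous_const),
      continuous_const.sub (continuous_id.smul continuous_const)⟩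
  have hf0 : f 0 = 1 := Units.ext (by simp [f])
  have hp : Tendsto (fun n : ℕ ↦ (p : ℤ_[p]) ^ n) atTop (𝓝 0) :=
    tendsto_pow_atTop_nhds_zero_of_norm_lt_one (PadicInt.norm_lt_one_iff_dvd _ |>.2 (by simp))
  have hmem : f ⁻¹' G ∈ 𝓝 (0 : ℤ_[p]) :=
    (hG.preimage hf).mem_nhds (by simp [hf0, G.one_mem])
  obtain ⟨n, hn⟩ := (hp.eventually hmem).exists
  exact ⟨(p : ℤ_[p]) ^ n, pow_ne_zero _ (NeZero.ne _), f _, hn, rfl⟩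

/-- A matrix commuting with an open subgroup of `GL₂(ℤ_p)` commutes with every matrix of square
zero. -/
theorem mul_comm_of_forall_mem_isOpen {p : ℕ} [Fact p.Prime]
    {G : Subgroup (GL (Fin 2) ℤ_[p])} (hG : IsOpen (G : Set (GL (Fin 2) ℤ_[p])))
    {g : GL (Fin 2) ℤ_[p]} (hg : ∀ h ∈ G, g * h = h * g)
    {N : Matrix (Fin 2) (Fin 2) ℤ_[p]} (hN : N * N = 0) :
    (g : Matrix (Fin 2) (Fin 2) ℤ_[p]) * N = N * g := by
  obtain ⟨c, hc, h, hh, hval⟩ := exists_one_add_smul_mem_of_isOpen hG hN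
  have key := congrArg Units.val (hg h hh)
  rw [Units.val_mul, Units.val_mul, hval] at key
  simp only [mul_add, add_mul, mul_one, one_mul, mul_smul_comm, smul_mul_assoc,
    add_right_inj] at key
  exact smul_right_injective _ hc key

/-- Let `p` be a prime and `G` an open subgroup of `GL₂(ℤ_p)`.
An element `g ∈ G` is central in `G` if and only if `g` is a scalar matrix
`u • I₂` for some unit `u` of `ℤ_p`. -/
theorem mem_center_open_subgroup_iff_scalar
    (p : ℕ) [Fact p.Prime]
    (G : Subgroup (GL (Fin 2) ℤ_[p]))
    (hG : IsOpen (G : Set (GL (Fin 2) ℤ_[p])))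
    (g : GL (Fin 2) ℤ_[p]) (hg : g ∈ G) :
    (∀ h ∈ G, g * h = h * g) ↔
      ∃ u : ℤ_[p]ˣ,
        (g : Matrix (Fin 2) (Fin 2) ℤ_[p]) =
          (u : ℤ_[p]) • (1 : Matrix (Fin 2) (Fin 2) ℤ_[p]) := by
  constructor
  · intro hcomm
    have upper := mul_comm_of_forall_mem_isOpen hG hcomm (N := !![0, 1; 0, 0])
      (by ext i j; fin_cases i <;> fin_cases j <;> simp)
    have lower := mul_comm_of_forall_mem_isOpen hG hcomm (N := !![0, 0; 1, 0])
      (by ext i j; fin_cases i <;> fin_cases j <;> simp)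
    have h10 : (g : Matrix (Fin 2) (Fin 2) ℤ_[p]) 1 0 = 0 := by
      simpa [Matrix.mul_apply] using congrFun₂ upper 1 1
    have h01 : (g : Matrix (Fin 2) (Fin 2) ℤ_[p]) 0 1 = 0 := by
      simpa [Matrix.mul_apply] using congrFun₂ lower 0 0
    have h11 : (g : Matrix (Fin 2) (Fin 2) ℤ_[p]) 0 0 = g 1 1 := by
      simpa [Matrix.mul_apply] using congrFun₂ upper 0 1
    have hdet : IsUnit (g : Matrix (Fin 2) (Fin 2) ℤ_[p]).det :=
      (Matrix.isUnit_iff_isUnit_det _).1 g.isUnit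
    rw [Matrix.det_fin_two, h10, mul_zero, sub_zero] at hdet
    obtain ⟨u, hu⟩ := isUnit_of_mul_isUnit_left hdet
    refine ⟨u, ?_⟩
    ext i j
    fin_cases i <;> fin_cases j <;> simp [hu, h10, h01, h11]
  · rintro ⟨u, hu⟩ h -
    exact Units.ext (by simp [hu])
end

section
/- Let p be a prime and n ≥ 1 an integer. Let Δ be a finite group whose order is coprime to p, and let W = Δ × ℤ where ℤ is the infinite cyclic group. Let A be an abelian group in which every element has p-power order and which is p-divisible, equipped with an action of W by group automorphisms such that the generator of the factor ℤ acts as multiplication by the integer 1+pⁿ. Then H¹(W, A) = 0. -/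
namespace groupCohomology

universe u

variable {k G : Type u} [CommRing k] [Group G] {A : Rep k G}

/-- A 1-cocycle which vanishes on a generating set is zero. -/
theorem cocycles₁_eq_zero_of_closure_eq_top (f : cocycles₁ A) {S : Set G}
    (hS : Subgroup.closure S = ⊤) (hf : ∀ g ∈ S, f g = 0) : f = 0 := by
  suffices h : ∀ g, f g = 0 from cocycles₁_ext h
  intro g
  have hg : g ∈ Subgroup.closure S := hS ▸ Subgroup.mem_top g
  induction hg using Subgroup.closure_induction with
  | mem g hg => exact hf g hg
  | one => exact cocycles₁_map_one f
  | mul g h _ _ hg hh =>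
    have h := (mem_cocycles₁_iff f.1).1 f.2 g h
    rwa [cocycles₁.val_eq_coe, hg, hh, map_zero, add_zero] at h
  | inv g _ hg =>
    have h := cocycles₁_map_inv f g
    rw [hg, neg_zero] at h
    rw [← A.ρ.inv_self_apply g (f g⁻¹), h, map_zero]

/-- A 1-cocycle whose restriction to a finite group is killed by an integer coprime to the order
of that group becomes a coboundary on it, with a primitive killed by the same integer. -/
theorem exists_primitive_of_zsmul_eq_zero_of_isCoprime_card (f : cocycles₁ A)
    {H : Type*} [Group H] [Fintype H] (φ : H →* G) {m : ℤ} (hm : IsCoprime (Fintype.card H : ℤ) m)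
    (hf : ∀ h, m • f (φ h) = 0) :
    ∃ b : A, m • b = 0 ∧ ∀ h, A.ρ (φ h) b - b = f (φ h) := by
  obtain ⟨u, v, huv⟩ := hm
  refine ⟨-(u • ∑ h, f (φ h)), ?_, fun g => ?_⟩
  · rw [smul_neg, smul_comm, Finset.smul_sum, Finset.sum_eq_zero fun h _ => hf h, smul_zero,
      neg_zero]
  · have key : A.ρ (φ g) (∑ h, f (φ h)) + Fintype.card H • f (φ g) = ∑ h, f (φ h) := by
      rw [map_sum, ← Finset.card_univ, ← Finset.sum_const, ← Finset.sum_add_distrib,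
        ← Equiv.sum_comp (Equiv.mulLeft g) fun h => f (φ h)]
      refine Finset.sum_congr rfl fun h _ => ?_
      rw [Equiv.coe_mulLeft, map_mul]
      exact ((mem_cocycles₁_iff f.1).1 f.2 (φ g) (φ h)).symm
    calc A.ρ (φ g) (-(u • ∑ h, f (φ h))) - -(u • ∑ h, f (φ h))
        = u • (∑ h, f (φ h) - A.ρ (φ g) (∑ h, f (φ h))) := by
          rw [map_neg, map_zsmul, smul_sub]; abel
      _ = u • (Fintype.card H : ℤ) • f (φ g) := by
          rw [natCast_zsmul, sub_eq_of_eq_add' key.symm]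
      _ = (u * Fintype.card H + v * m) • f (φ g) := by
          rw [add_smul, mul_smul, mul_smul, hf, smul_zero, add_zero]
      _ = f (φ g) := by rw [huv, one_smul]

end groupCohomology

theorem Subgroup.closure_insert_ofAdd_one_range_inl (Δ : Type*) [Group Δ] :
    Subgroup.closure (insert ((1 : Δ), Multiplicative.ofAdd (1 : ℤ))
      (Set.range (MonoidHom.inl Δ (Multiplicative ℤ)))) = ⊤ := by
  refine eq_top_iff.2 fun ⟨δ, z⟩ _ => ?_
  have h : (δ, z) = MonoidHom.inl Δ (Multiplicative ℤ) δ *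
      ((1 : Δ), Multiplicative.ofAdd (1 : ℤ)) ^ z.toAdd := by
    ext
    · simp
    · simp [← ofAdd_zsmul]
  rw [h]
  exact mul_mem (subset_closure (Set.mem_insert_of_mem _ ⟨δ, rfl⟩))
    (zpow_mem (subset_closure (Set.mem_insert _ _)) _)

open groupCohomology

/-- Let `p` be a prime and `n ≥ 1`.  Let `Δ` be a finite group of
order coprime to `p`, and let `W = Δ × ℤ` (the second factor written multiplicatively
as `Multiplicative ℤ`).  Let `A = (V, ρ)` be an abelian group which is `p`-primary
torsion and `p`-divisible, with an action of `W` such that the generator of the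
factor `ℤ` acts as multiplication by the integer `1 + pⁿ`.  Then `H¹(W, A) = 0`. -/
theorem h1_prod_eq_zero_of_generator_acts_as_one_add_pow
    (p : ℕ) (hp : p.Prime) (n : ℕ) (hn : 1 ≤ n)
    (Δ : Type) [Group Δ] [Fintype Δ] (hΔ : Nat.Coprime (Fintype.card Δ) p)
    (V : Type) [AddCommGroup V]
    (ρ : Representation ℤ (Δ × Multiplicative ℤ) V)
    (htors : ∀ a : V, ∃ k : ℕ, ((p : ℤ) ^ k) • a = 0)
    (hdiv : ∀ a : V, ∃ b : V, (p : ℤ) • b = a)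
    (hgen : ∀ a : V, ρ (1, Multiplicative.ofAdd 1) a = (1 + (p : ℤ) ^ n) • a) :
    Subsingleton (groupCohomology (Rep.of ρ) 1) := by
  have hdivpow (m : ℕ) (a : V) : ∃ b : V, ((p : ℤ) ^ m) • b = a := by
    induction m generalizing a with
    | zero => exact ⟨a, by simp⟩
    | succ m ih =>
      obtain ⟨b, rfl⟩ := ih a
      obtain ⟨c, rfl⟩ := hdiv b
      exact ⟨c, by rw [pow_succ, mul_smul]⟩
  have hgen' (a : V) : ρ (1, Multiplicative.ofAdd 1) a - a = ((p : ℤ) ^ n) • a := by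
    rw [hgen, add_smul, one_smul, add_sub_cancel_left]
  let d (x : V) : cocycles₁ (Rep.of ρ) := ⟨_, d₀₁_apply_mem_cocycles₁ (A := Rep.of ρ) x⟩
  have hd (x : V) (g : Δ × Multiplicative ℤ) : d x g = ρ g x - x := rfl
  refine subsingleton_of_forall_eq 0 fun y => ?_
  induction y using H1_induction_on with | h f => ?_
  rw [H1π_eq_zero_iff]
  obtain ⟨a, ha⟩ := hdivpow n (f (1, Multiplicative.ofAdd 1))
  let f' : cocycles₁ (Rep.of ρ) := f - d a
  have hf' (g : Δ × Multiplicative ℤ) : f' g = f g - (ρ g a - a) := rfl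
  have hσ : f' (1, Multiplicative.ofAdd 1) = 0 := by
    rw [hf', hgen', ha, sub_self]
  have hkill (δ : Δ) : ((p : ℤ) ^ n) • f' (MonoidHom.inl Δ (Multiplicative ℤ) δ) = 0 := by
    have hcoc := (mem_cocycles₁_iff f'.1).1 f'.2
    have h₁ := hcoc (δ, 1) (1, Multiplicative.ofAdd 1)
    have h₂ := hcoc (1, Multiplicative.ofAdd 1) (δ, 1)
    rw [cocycles₁.val_eq_coe, hσ, map_zero, zero_add] at h₁
    rw [cocycles₁.val_eq_coe, hσ, add_zero] at h₂
    have hcomm : ((δ, 1) : Δ × Multiplicative ℤ) * (1, Multiplicative.ofAdd 1) =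
        (1, Multiplicative.ofAdd 1) * (δ, 1) := by simp
    rw [hcomm, h₂] at h₁
    exact (hgen' _).symm.trans (sub_eq_zero.2 h₁)
  obtain ⟨b, hb, hb'⟩ := exists_primitive_of_zsmul_eq_zero_of_isCoprime_card f'
    (MonoidHom.inl Δ (Multiplicative ℤ))
    (IsCoprime.pow_right (Nat.isCoprime_iff_coprime.2 hΔ)) hkill
  have hzero : f' - d b = 0 := by
    refine cocycles₁_eq_zero_of_closure_eq_top _
      (Subgroup.closure_insert_ofAdd_one_range_inl Δ) ?_
    rintro _ (rfl | ⟨δ, rfl⟩)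
    · change f' _ - d b _ = 0
      rw [hσ, hd, hgen', hb, sub_zero]
    · exact sub_eq_zero.2 (hb' δ).symm
  have hf : f = d (a + b) := by
    have h : f = d a + d b := by rw [← sub_eq_zero.1 hzero, add_sub_cancel]
    rw [h]
    refine cocycles₁_ext fun g => ?_
    change (ρ g a - a) + (ρ g b - b) = ρ g (a + b) - (a + b)
    rw [map_add]; abel
  exact ⟨a + b, congrArg Subtype.val hf.symm⟩
end
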